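/- Fix integers n ≥ 2 and r ≥ 1, and in the polynomial ring (ZMod 5)[Y] define LΔ = (4Y+1)^(4r·5^n) − (4Y+1)^(2r·5^n); LC₀ = 4·(r : ZMod 5)·Y^(24·5^(n−2))·((4Y+1)^((100r−16)·5^(n−2)) − (4Y+1)^((50r−8)·5^(n−2))); LD₀ = 3·(r : ZMod 5)·Y^(27·5^(n−2))·((4Y+1)^((100r−18)·5^(n−2)) + (4Y+1)^((50r−9)·5^(n−2))); and for 1 ≤ m ≤ n−2, LC_m = 3·(r : ZMod 5)·Y^(6·5^(n−1)−6·5^(n−m−2))·((4Y+1)^(16·5^(n−1)+4·5^(n−m−2)+4(r−1)·5^n) − (4Y+1)^(8·5^(n−1)+2·5^(n−m−2)+2(r−1)·5^n)) and LD_m = (r : ZMod 5)·Y^(6·5^(n−1)−3·5^(n−m−2))·((4Y+1)^(16·5^(n−1)+2·5^(n−m−2)+4(r−1)·5^n) + (4Y+1)^(8·5^(n−1)+5^(n−m−2)+2(r−1)·5^n)). Then for every integer u with 1 ≤ u ≤ n−1, the polynomial Y^(5^n + 5^(n−1) − 5^(n−u) + 2·5^(n−u−1)) divides LΔ + Σ_{m=0}^{u−2}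 (LC_m + LD_m) + LC_{u−1} (the sum over m being empty when u = 1). -/

import Mathlib

open Polynomial Finset

/-- `LΔ = (4Y+1)^(4r·5^n) - (4Y+1)^(2r·5^n)` in `(ZMod 5)[Y]`. -/
noncomputable def Ldelta (n r : ℕ) : Polynomial (ZMod 5) :=
  (4 * X + 1) ^ (4 * r * 5 ^ n) - (4 * X + 1) ^ (2 * r * 5 ^ n)

/-- `LC_m` in `(ZMod 5)[Y]`: for `m = 0` the image of `C_{0,n,r}` under `L₂`, and
for `1 ≤ m ≤ n-2` the image of `C_{m,n,r}`. -/
noncomputable def LC (n r m : ℕ) : Polynomial (ZMod 5) :=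
  if m = 0 then
    4 * C (r : ZMod 5) * X ^ (24 * 5 ^ (n - 2)) *
      ((4 * X + 1) ^ ((100 * r - 16) * 5 ^ (n - 2))
        - (4 * X + 1) ^ ((50 * r - 8) * 5 ^ (n - 2)))
  else
    3 * C (r : ZMod 5) * X ^ (6 * 5 ^ (n - 1) - 6 * 5 ^ (n - m - 2)) *
      ((4 * X + 1) ^ (16 * 5 ^ (n - 1) + 4 * 5 ^ (n - m - 2) + 4 * (r - 1) * 5 ^ n)
        - (4 * X + 1) ^ (8 * 5 ^ (n - 1) + 2 * 5 ^ (n - m - 2) + 2 * (r - 1) * 5 ^ n))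

/-- `LD_m` in `(ZMod 5)[Y]`: for `m = 0` the image of `D_{0,n,r}` under `L₂`, and
for `1 ≤ m ≤ n-2` the image of `D_{m,n,r}`. -/
noncomputable def LD (n r m : ℕ) : Polynomial (ZMod 5) :=
  if m = 0 then
    3 * C (r : ZMod 5) * X ^ (27 * 5 ^ (n - 2)) *
      ((4 * X + 1) ^ ((100 * r - 18) * 5 ^ (n - 2))
        + (4 * X + 1) ^ ((50 * r - 9) * 5 ^ (n - 2)))
  else
    C (r : ZMod 5) * X ^ (6 * 5 ^ (n - 1) - 3 * 5 ^ (n - m - 2)) *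
      ((4 * X + 1) ^ (16 * 5 ^ (n - 1) + 2 * 5 ^ (n - m - 2) + 4 * (r - 1) * 5 ^ n)
        + (4 * X + 1) ^ (8 * 5 ^ (n - 1) + 5 ^ (n - m - 2) + 2 * (r - 1) * 5 ^ n))


/-- In characteristic `5` the Frobenius gives `(4Y+1)^(5^k) = 1 - Y^(5^k)`. -/
lemma four_mul_X_add_one_pow (k : ℕ) :
    (4 * X + 1 : (ZMod 5)[X]) ^ 5 ^ k = 1 - X ^ 5 ^ k := by
  have h5 : (5 : (ZMod 5)[X]) = 0 := CharP.cast_eq_zero (ZMod 5)[X] 5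
  have h : (4 * X + 1 : (ZMod 5)[X]) = 1 - X := by linear_combination X * h5
  have : Fact (Nat.Prime 5) := ⟨by norm_num⟩
  rw [h, sub_pow_char_pow, one_pow]

lemma X_pow_dvd_four_mul_X_add_one_pow_sub_one (k e : ℕ) :
    (X : (ZMod 5)[X]) ^ 5 ^ k ∣ (4 * X + 1) ^ (5 ^ k * e) - 1 := by
  rw [pow_mul, four_mul_X_add_one_pow]
  refine dvd_trans ?_ (sub_one_dvd_pow_sub_one _ e)
  exact ⟨-1, by ring⟩

lemma sq_dvd_one_sub_pow_sub {R : Type*} [CommRing R] (z : R) (k : ℕ) :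
    z ^ 2 ∣ (1 - z) ^ k - (1 - k * z) := by
  induction k with
  | zero => simp
  | succ k ih =>
    obtain ⟨g, hg⟩ := ih
    refine ⟨g * (1 - z) + k, ?_⟩
    push_cast
    linear_combination (1 - z) * hg

lemma X_pow_dvd_Ldelta_add (n r : ℕ) :
    (X : (ZMod 5)[X]) ^ (2 * 5 ^ n) ∣ Ldelta n r + 2 * C (r : ZMod 5) * X ^ 5 ^ n := by
  obtain ⟨g, hg⟩ := sq_dvd_one_sub_pow_sub ((X : (ZMod 5)[X]) ^ 5 ^ n) (4 * r)
  obtain ⟨g', hg'⟩ := sq_dvd_one_sub_pow_sub ((X : (ZMod 5)[X]) ^ 5 ^ n) (2 * r)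
  refine ⟨g - g', ?_⟩
  rw [Ldelta, mul_comm (4 * r), mul_comm (2 * r), pow_mul _ (5 ^ n),
    pow_mul _ (5 ^ n), four_mul_X_add_one_pow, mul_comm 2 (5 ^ n), pow_mul X, map_natCast]
  push_cast at hg hg'
  linear_combination hg - hg'

lemma six_mul_pow_le {n m : ℕ} (hm : 1 ≤ m) (hmn : m + 2 ≤ n) :
    6 * 5 ^ (n - m - 2) ≤ 5 ^ (n - 1) := by
  have h : 5 ^ (n - 1) = 5 ^ (n - m - 2) * 5 ^ (m + 1) := by rw [← pow_add]; congr 1; omega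
  have h' : 5 ^ 2 ≤ 5 ^ (m + 1) := Nat.pow_le_pow_right (by norm_num) (by omega)
  nlinarith [Nat.zero_le (5 ^ (n - m - 2))]

/-- Each `LC_m` with `m ≥ 1`, modulo `Y^(6·5^(n-1))`. -/
lemma X_pow_dvd_LC_sub {n m : ℕ} (r : ℕ) (hm : 1 ≤ m) (hmn : m + 2 ≤ n) :
    (X : (ZMod 5)[X]) ^ (6 * 5 ^ (n - 1)) ∣ LC n r m - C (r : ZMod 5) *
      X ^ (6 * 5 ^ (n - 1) - 6 * 5 ^ (n - m - 2)) *
        (-X ^ 5 ^ (n - m - 2) + 3 * X ^ (3 * 5 ^ (n - m - 2)) + 3 * X ^ (4 * 5 ^ (n - m - 2))) := by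
  have h5 : (5 : (ZMod 5)[X]) = 0 := CharP.cast_eq_zero (ZMod 5)[X] 5
  have hP : 6 * 5 ^ (n - m - 2) ≤ 5 ^ (n - 1) := six_mul_pow_le hm hmn
  have hn : 5 ^ n = 5 ^ (n - 1) * 5 := by rw [← pow_succ]; congr 1; omega
  have key (e : ℕ) : (X ^ 5 ^ (n - m - 2) : (ZMod 5)[X]) ^ 6 ∣
      (4 * X + 1) ^ (5 ^ (n - 1) * e) - 1 := by
    rw [← pow_mul, mul_comm _ 6]
    exact (pow_dvd_pow _ hP).trans (X_pow_dvd_four_mul_X_add_one_pow_sub_one _ _)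
  obtain ⟨g, hg⟩ := key (16 + 20 * (r - 1))
  obtain ⟨g', hg'⟩ := key (8 + 10 * (r - 1))
  have hb := four_mul_X_add_one_pow (n - m - 2)
  have hN : (X : (ZMod 5)[X]) ^ (6 * 5 ^ (n - 1)) =
      X ^ (6 * 5 ^ (n - 1) - 6 * 5 ^ (n - m - 2)) * (X ^ 5 ^ (n - m - 2)) ^ 6 := by
    rw [← pow_mul, ← pow_add]; congr 1; omega
  rw [LC, if_neg (by omega), hN, hn]
  generalize 5 ^ (n - m - 2) = q at *
  generalize 5 ^ (n - 1) = P at *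
  rw [show 16 * P + 4 * q + 4 * (r - 1) * (P * 5) = P * (16 + 20 * (r - 1)) + q * 4 by ring,
    show 8 * P + 2 * q + 2 * (r - 1) * (P * 5) = P * (8 + 10 * (r - 1)) + q * 2 by ring,
    pow_add _ _ (q * 4), pow_add _ _ (q * 2), pow_mul _ q, pow_mul _ q, hb,
    sub_eq_iff_eq_add.1 hg, sub_eq_iff_eq_add.1 hg', mul_comm 3 q, mul_comm 4 q,
    pow_mul _ q, pow_mul _ q]
  generalize (X : (ZMod 5)[X]) ^ q = w
  generalize (X : (ZMod 5)[X]) ^ (6 * P - 6 * q) = Z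
  refine ⟨3 * C (r : ZMod 5) * (g * (1 - w) ^ 4 - g' * (1 - w) ^ 2), ?_⟩
  linear_combination C (r : ZMod 5) * Z * (-w + 3 * w ^ 2 - 3 * w ^ 3) * h5

/-- Each `LC_m + LD_m` with `m ≥ 1` telescopes modulo `Y^(6·5^(n-1))`. -/
lemma X_pow_dvd_LC_add_LD_sub {n m : ℕ} (r : ℕ) (hm : 1 ≤ m) (hmn : m + 2 ≤ n) :
    (X : (ZMod 5)[X]) ^ (6 * 5 ^ (n - 1)) ∣ LC n r m + LD n r m - C (r : ZMod 5) *
      (X ^ (6 * 5 ^ (n - 1) - 5 ^ (n - m - 2)) - X ^ (6 * 5 ^ (n - 1) - 5 ^ (n - m - 1))) := by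
  have h5 : (5 : (ZMod 5)[X]) = 0 := CharP.cast_eq_zero (ZMod 5)[X] 5
  have hP : 6 * 5 ^ (n - m - 2) ≤ 5 ^ (n - 1) := six_mul_pow_le hm hmn
  have hn : 5 ^ n = 5 ^ (n - 1) * 5 := by rw [← pow_succ]; congr 1; omega
  have hq : 5 ^ (n - m - 1) = 5 * 5 ^ (n - m - 2) := by rw [← pow_succ']; congr 1; omega
  have key (e : ℕ) : (X ^ 5 ^ (n - m - 2) : (ZMod 5)[X]) ^ 3 ∣
      (4 * X + 1) ^ (5 ^ (n - 1) * e) - 1 := by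
    rw [← pow_mul]
    exact (pow_dvd_pow _ (by omega)).trans (X_pow_dvd_four_mul_X_add_one_pow_sub_one _ _)
  obtain ⟨c, hc⟩ := X_pow_dvd_LC_sub r hm hmn
  obtain ⟨g, hg⟩ := key (16 + 20 * (r - 1))
  obtain ⟨g', hg'⟩ := key (8 + 10 * (r - 1))
  have hb := four_mul_X_add_one_pow (n - m - 2)
  have hX (i : ℕ) (hi : i ≤ 6) :
      (X : (ZMod 5)[X]) ^ (6 * 5 ^ (n - 1) - i * 5 ^ (n - m - 2)) =
      X ^ (6 * 5 ^ (n - 1) - 6 * 5 ^ (n - m - 2)) * (X ^ 5 ^ (n - m - 2)) ^ (6 - i) := by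
    rw [← pow_mul, ← pow_add]; congr 1; interval_cases i <;> omega
  have h0 := hX 0 (by norm_num)
  have h1 := hX 1 (by norm_num)
  simp only [zero_mul, one_mul, Nat.sub_zero] at h0 h1
  rw [sub_eq_iff_eq_add.1 hc, LD, if_neg (by omega), hn, hq, hX 3 (by norm_num),
    hX 5 (by norm_num), h0, h1]
  clear hX hc h0 h1 key
  generalize 5 ^ (n - m - 2) = q at *
  generalize 5 ^ (n - 1) = P at *
  rw [show 16 * P + 2 * q + 4 * (r - 1) * (P * 5) = P * (16 + 20 * (r - 1)) + q * 2 by ring,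
    show 8 * P + q + 2 * (r - 1) * (P * 5) = P * (8 + 10 * (r - 1)) + q by ring,
    pow_add _ _ (q * 2), pow_add _ _ q, pow_mul _ q, hb,
    sub_eq_iff_eq_add.1 hg, sub_eq_iff_eq_add.1 hg', mul_comm 3 q, mul_comm 4 q,
    pow_mul _ q, pow_mul _ q]
  generalize (X : (ZMod 5)[X]) ^ q = w
  generalize (X : (ZMod 5)[X]) ^ (6 * P - 6 * q) = Z
  refine ⟨c + C (r : ZMod 5) * (g * (1 - w) ^ 2 + g' * (1 - w)), ?_⟩
  linear_combination C (r : ZMod 5) * Z * w ^ 3 * h5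

lemma X_pow_dvd_Ldelta_add_LC_zero (k : ℕ) {r : ℕ} (hr : 1 ≤ r) :
    (X : (ZMod 5)[X]) ^ (27 * 5 ^ k) ∣ Ldelta (k + 2) r + LC (k + 2) r 0 := by
  obtain ⟨s, rfl⟩ : ∃ s, r = s + 1 := ⟨r - 1, by omega⟩
  have h5 : (5 : (ZMod 5)[X]) = 0 := CharP.cast_eq_zero (ZMod 5)[X] 5
  have hb := four_mul_X_add_one_pow k
  have hk : 5 ^ (k + 2) = 25 * 5 ^ k := by ring
  obtain ⟨d, hd⟩ := X_pow_dvd_Ldelta_add (k + 2) (s + 1)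
  obtain ⟨g, hg⟩ := X_pow_dvd_four_mul_X_add_one_pow_sub_one (k + 2) (4 * s + 3)
  obtain ⟨g', hg'⟩ := X_pow_dvd_four_mul_X_add_one_pow_sub_one (k + 2) (2 * s + 1)
  rw [hk] at hd hg hg'
  rw [eq_sub_of_add_eq hd, LC, if_pos rfl, Nat.add_sub_cancel,
    show (100 * (s + 1) - 16) * 5 ^ k = 25 * 5 ^ k * (4 * s + 3) + 5 ^ k * 9 by
      rw [show 100 * (s + 1) - 16 = 100 * s + 84 by omega]; ring,
    show (50 * (s + 1) - 8) * 5 ^ k = 25 * 5 ^ k * (2 * s + 1) + 5 ^ k * 17 by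
      rw [show 50 * (s + 1) - 8 = 50 * s + 42 by omega]; ring]
  generalize 5 ^ k = q at *
  rw [pow_add _ _ (q * 9), pow_add _ _ (q * 17), pow_mul _ q, pow_mul _ q, hb,
    sub_eq_iff_eq_add.1 hg, sub_eq_iff_eq_add.1 hg', ← mul_assoc 2 25 q,
    mul_comm _ q, mul_comm _ q, mul_comm _ q, mul_comm _ q,
    pow_mul _ q, pow_mul _ q, pow_mul _ q, pow_mul _ q]
  generalize (X : (ZMod 5)[X]) ^ q = w
  generalize C ((s + 1 : ℕ) : ZMod 5) = R
  refine ⟨w ^ 23 * d + 4 * R * w ^ 22 * (g * (1 - w) ^ 9 - g' * (1 - w) ^ 17) +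
    R * (-1 - w - 2 * w ^ 2 + 2 * w ^ 3 - 2 * w ^ 4 + w ^ 5 + w ^ 6 - 2 * w ^ 7 - w ^ 8 -
      2 * w ^ 9 - w ^ 12 + 2 * w ^ 13 - w ^ 14), ?_⟩
  linear_combination R * w ^ 24 * (6 * w - 80 * w ^ 2 + 477 * w ^ 3 - 1803 * w ^ 4 +
      4850 * w ^ 5 - 9834 * w ^ 6 + 15530 * w ^ 7 - 19441 * w ^ 8 + 19447 * w ^ 9 -
      15558 * w ^ 10 + 9901 * w ^ 11 - 4950 * w ^ 12 + 1904 * w ^ 13 - 544 * w ^ 14 +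
      109 * w ^ 15 - 14 * w ^ 16 + w ^ 17) * h5

lemma X_pow_dvd_Ldelta_add_LC_zero_add_LD_zero (k : ℕ) {r : ℕ} (hr : 1 ≤ r) :
    (X : (ZMod 5)[X]) ^ (30 * 5 ^ k) ∣ Ldelta (k + 2) r + (LC (k + 2) r 0 + LD (k + 2) r 0)
      - C (r : ZMod 5) * X ^ (29 * 5 ^ k) := by
  obtain ⟨s, rfl⟩ : ∃ s, r = s + 1 := ⟨r - 1, by omega⟩
  have h5 : (5 : (ZMod 5)[X]) = 0 := CharP.cast_eq_zero (ZMod 5)[X] 5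
  have hb := four_mul_X_add_one_pow k
  have hk : 5 ^ (k + 2) = 25 * 5 ^ k := by ring
  obtain ⟨d, hd⟩ := X_pow_dvd_Ldelta_add (k + 2) (s + 1)
  obtain ⟨g, hg⟩ := X_pow_dvd_four_mul_X_add_one_pow_sub_one (k + 2) (4 * s + 3)
  obtain ⟨g', hg'⟩ := X_pow_dvd_four_mul_X_add_one_pow_sub_one (k + 2) (2 * s + 1)
  rw [hk] at hd hg hg'
  rw [eq_sub_of_add_eq hd, LC, LD, if_pos rfl, if_pos rfl, Nat.add_sub_cancel,
    show (100 * (s + 1) - 16) * 5 ^ k = 25 * 5 ^ k * (4 * s + 3) + 5 ^ k * 9 by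
      rw [show 100 * (s + 1) - 16 = 100 * s + 84 by omega]; ring,
    show (50 * (s + 1) - 8) * 5 ^ k = 25 * 5 ^ k * (2 * s + 1) + 5 ^ k * 17 by
      rw [show 50 * (s + 1) - 8 = 50 * s + 42 by omega]; ring,
    show (100 * (s + 1) - 18) * 5 ^ k = 25 * 5 ^ k * (4 * s + 3) + 5 ^ k * 7 by
      rw [show 100 * (s + 1) - 18 = 100 * s + 82 by omega]; ring,
    show (50 * (s + 1) - 9) * 5 ^ k = 25 * 5 ^ k * (2 * s + 1) + 5 ^ k * 16 by
      rw [show 50 * (s + 1) - 9 = 50 * s + 41 by omega]; ring]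
  generalize 5 ^ k = q at *
  rw [pow_add _ _ (q * 9), pow_add _ _ (q * 17), pow_add _ _ (q * 7), pow_add _ _ (q * 16),
    pow_mul _ q 9, pow_mul _ q 17, pow_mul _ q 7, pow_mul _ q 16, hb,
    sub_eq_iff_eq_add.1 hg, sub_eq_iff_eq_add.1 hg', ← mul_assoc 2 25 q,
    mul_comm _ q, mul_comm _ q, mul_comm _ q, mul_comm _ q, mul_comm _ q, mul_comm _ q,
    pow_mul _ q, pow_mul _ q, pow_mul _ q, pow_mul _ q, pow_mul _ q, pow_mul _ q]
  generalize (X : (ZMod 5)[X]) ^ q = w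
  generalize C ((s + 1 : ℕ) : ZMod 5) = R
  refine ⟨w ^ 20 * d + 4 * R * w ^ 19 * (g * (1 - w) ^ 9 - g' * (1 - w) ^ 17) +
    3 * R * w ^ 22 * (g * (1 - w) ^ 7 + g' * (1 - w) ^ 16) +
    R * (2 - 2 * w - w ^ 2 + w ^ 3 - w ^ 5 - 2 * w ^ 6 - w ^ 7 + w ^ 8 - w ^ 9 + 2 * w ^ 10 -
      w ^ 11 + 2 * w ^ 12 - 2 * w ^ 13), ?_⟩
  linear_combination R * w ^ 24 * (6 * w - 80 * w ^ 2 + 478 * w ^ 3 - 1817 * w ^ 4 +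
      4934 * w ^ 5 - 10191 * w ^ 6 + 16643 * w ^ 7 - 22074 * w ^ 8 + 24256 * w ^ 9 -
      22423 * w ^ 10 + 17623 * w ^ 11 - 11814 * w ^ 12 + 6709 * w ^ 13 - 3165 * w ^ 14 +
      1201 * w ^ 15 - 350 * w ^ 16 + 73 * w ^ 17 - 10 * w ^ 18 + w ^ 19) * h5

/-- The partial sums through `LD_(k-1)` reduce to one monomial modulo `Y^(6·5^(n-1))`. -/
lemma X_pow_dvd_Ldelta_add_sum_sub {n r k : ℕ} (hr : 1 ≤ r) (hk : 1 ≤ k) (hkn : k + 1 ≤ n) :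
    (X : (ZMod 5)[X]) ^ (6 * 5 ^ (n - 1)) ∣
      Ldelta n r + ∑ m ∈ Finset.range k, (LC n r m + LD n r m)
        - C (r : ZMod 5) * X ^ (6 * 5 ^ (n - 1) - 5 ^ (n - k - 1)) := by
  induction k, hk using Nat.le_induction with
  | base =>
    obtain ⟨i, rfl⟩ : ∃ i, n = i + 2 := ⟨n - 2, by omega⟩
    have h1 : 6 * 5 ^ (i + 2 - 1) = 30 * 5 ^ i := by
      rw [show i + 2 - 1 = i + 1 by omega, pow_succ]; ring
    have h2 : 30 * 5 ^ i - 5 ^ (i + 2 - 1 - 1) = 29 * 5 ^ i := by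
      rw [show i + 2 - 1 - 1 = i by omega]; omega
    rw [h1, h2, Finset.sum_range_one]
    exact X_pow_dvd_Ldelta_add_LC_zero_add_LD_zero i hr
  | succ k hk ih =>
    have h := dvd_add (ih (by omega)) (X_pow_dvd_LC_add_LD_sub r hk (by omega : k + 2 ≤ n))
    rw [Finset.sum_range_succ, show n - (k + 1) - 1 = n - k - 2 by omega]
    convert h using 1
    ring

/-- Theorem 4.11, second case: for `n ≥ 2`, `r ≥ 1`, and `1 ≤ u ≤ n-1`,
`Y^(5^n + 5^(n-1) - 5^(n-u) + 2·5^(n-u-1))` divides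
`LΔ + Σ_{m=0}^{u-2} (LC_m + LD_m) + LC_{u-1}` (the sum being empty when `u = 1`). -/
theorem stmt_9 (n r : ℕ) (hn : 2 ≤ n) (hr : 1 ≤ r) (u : ℕ) (hu1 : 1 ≤ u) (hu2 : u ≤ n - 1) :
    (X : Polynomial (ZMod 5)) ^ (5 ^ n + 5 ^ (n - 1) - 5 ^ (n - u) + 2 * 5 ^ (n - u - 1)) ∣
      Ldelta n r + ∑ m ∈ Finset.range (u - 1), (LC n r m + LD n r m) + LC n r (u - 1) := by
  obtain ⟨k, rfl⟩ : ∃ k, u = k + 1 := ⟨u - 1, by omega⟩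
  rw [Nat.add_sub_cancel]
  have hn' : 5 ^ n = 5 * 5 ^ (n - 1) := by rw [← pow_succ']; congr 1; omega
  rcases Nat.eq_zero_or_pos k with rfl | hk
  · obtain ⟨i, rfl⟩ : ∃ i, n = i + 2 := ⟨n - 2, by omega⟩
    have h : 5 ^ (i + 2) + 5 ^ (i + 2 - 1) - 5 ^ (i + 2 - (0 + 1)) +
        2 * 5 ^ (i + 2 - (0 + 1) - 1) = 27 * 5 ^ i := by
      rw [show i + 2 - (0 + 1) = i + 1 from rfl, Nat.add_sub_cancel, Nat.add_sub_cancel]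
      ring
    rw [h, Finset.sum_range_zero, add_zero]
    exact X_pow_dvd_Ldelta_add_LC_zero i hr
  · have hS := X_pow_dvd_Ldelta_add_sum_sub hr hk (by omega : k + 1 ≤ n)
    have hC := X_pow_dvd_LC_sub r hk (by omega : k + 2 ≤ n)
    have hP := six_mul_pow_le hk (by omega : k + 2 ≤ n)
    have hq : 5 ^ (n - (k + 1)) = 5 * 5 ^ (n - k - 2) := by rw [← pow_succ']; congr 1; omega
    rw [show n - k - 1 = n - (k + 1) by omega] at hS
    rw [show n - (k + 1) - 1 = n - k - 2 by omega, hn']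
    rw [hq] at hS ⊢
    generalize 5 ^ (n - k - 2) = q at *
    generalize 5 ^ (n - 1) = P at *
    obtain ⟨a, ha⟩ := hS
    obtain ⟨c, hc⟩ := hC
    obtain ⟨T, hT⟩ : ∃ T, 6 * P = T + q * 6 := ⟨6 * P - q * 6, by omega⟩
    rw [show 6 * P - 5 * q = T + q by omega, hT, pow_add, pow_add, pow_mul _ q] at ha
    rw [show 6 * P - 6 * q = T by omega, hT, mul_comm 3 q, mul_comm 4 q, pow_add,
      pow_mul _ q, pow_mul _ q, pow_mul _ q] at hc
    rw [show 5 * P + P - 5 * q + 2 * q = T + q * 3 by omega, pow_add, pow_mul _ q]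
    refine ⟨(X ^ q) ^ 3 * (a + c) + C (r : ZMod 5) * (3 + 3 * X ^ q), ?_⟩
    linear_combination ha + hc
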